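/- arXiv:2410.17102 — 6 statements merged into one kernel-verified Lean document; each statement's English description precedes it below -/
import Mathlib

section
/- Let A be an abelian category and F : A ⥤ A an exact endofunctor (i.e. F preserves finite limits and finite colimits). Then the category Endofunctor.Algebra F is abelian, and the forgetful functor Endofunctor.Algebra F ⥤ A is exact (preserves finite limits and finite colimits). -/
open CategoryTheory CategoryTheory.Limits

universe v u

namespace CategoryTheory.Endofunctor.Algebra

universe w₁ w₂

variable {C : Type u} [Category.{v} C] {F : C ⥤ C} {J : Type w₂} [Category.{w₁} J]

/-- The structure maps of a diagram of algebras, as a natural transformation. -/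
def strNatTrans (D : J ⥤ Algebra F) : (D ⋙ forget F) ⋙ F ⟶ D ⋙ forget F where
  app j := (D.obj j).str
  naturality _ _ f := (D.map f).h

/-- The lift to algebras of a limit cone on the underlying diagram. -/
def liftedCone {D : J ⥤ Algebra F} {c : Cone (D ⋙ forget F)} (t : IsLimit c) : Cone D where
  pt :=
    { a := c.pt
      str := t.lift ((Cone.postcompose (strNatTrans D)).obj (F.mapCone c)) }
  π :=
    { app j :=
        { f := c.π.app j
          h := (t.fac ((Cone.postcompose (strNatTrans D)).obj (F.mapCone c)) j).symm }
      naturality _ _ f := Hom.ext (c.π.naturality f) }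

/-- The lifted cone is a limit cone. -/
def liftedConeIsLimit {D : J ⥤ Algebra F} {c : Cone (D ⋙ forget F)} (t : IsLimit c) :
    IsLimit (liftedCone t) where
  lift s :=
    { f := t.lift ((forget F).mapCone s)
      h := t.hom_ext fun j => by
        have fac := t.fac ((forget F).mapCone s) j
        refine (Category.assoc _ _ _).trans
          ((congrArg (_ ≫ ·) ((liftedCone t).π.app j).h.symm).trans ?_)
        refine (Category.assoc _ _ _).symm.trans ((congrArg (· ≫ (D.obj j).str)
          ((F.map_comp _ _).symm.trans (congrArg (fun g => F.map g) fac))).trans ?_)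
        exact (s.π.app j).h.trans
          ((Category.assoc _ _ _).trans (congrArg (_ ≫ ·) fac)).symm }
  fac s j := Hom.ext (t.fac ((forget F).mapCone s) j)
  uniq s _ h := Hom.ext (t.uniq ((forget F).mapCone s) _ fun j => congrArg Hom.f (h j))

/-- The forgetful functor from algebras over an endofunctor creates limits. -/
instance forgetCreatesLimitsOfShape : CreatesLimitsOfShape J (forget F) where
  CreatesLimit := createsLimitOfReflectsIso fun _ t =>
    { liftedCone := liftedCone t
      validLift := Cone.ext (Iso.refl _) fun _ => (Category.id_comp _).symm
      makesLimit := liftedConeIsLimit t }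

section Colimits

variable [PreservesColimitsOfShape J F]

/-- The lift to algebras of a colimit cocone on the underlying diagram, when `F` preserves it. -/
noncomputable def liftedCocone {D : J ⥤ Algebra F} {c : Cocone (D ⋙ forget F)}
    (t : IsColimit c) : Cocone D where
  pt :=
    { a := c.pt
      str := (isColimitOfPreserves F t).desc ((Cocone.precompose (strNatTrans D)).obj c) }
  ι :=
    { app j :=
        { f := c.ι.app j
          h := (isColimitOfPreserves F t).fac ((Cocone.precompose (strNatTrans D)).obj c) j }
      naturality _ _ f := Hom.ext (c.ι.naturality f) }

/-- The lifted cocone is a colimit cocone. -/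
noncomputable def liftedCoconeIsColimit {D : J ⥤ Algebra F} {c : Cocone (D ⋙ forget F)}
    (t : IsColimit c) : IsColimit (liftedCocone t) where
  desc s :=
    { f := t.desc ((forget F).mapCocone s)
      h := (isColimitOfPreserves F t).hom_ext fun j => by
        have fac := t.fac ((forget F).mapCocone s) j
        refine (Category.assoc _ _ _).symm.trans ((congrArg (· ≫ s.pt.str)
          ((F.map_comp _ _).symm.trans (congrArg (fun g => F.map g) fac))).trans ?_)
        refine (s.ι.app j).h.trans ((congrArg (_ ≫ ·) fac.symm).trans ?_)
        exact (Category.assoc _ _ _).symm.trans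
          ((congrArg (· ≫ _) ((liftedCocone t).ι.app j).h.symm).trans (Category.assoc _ _ _)) }
  fac s j := Hom.ext (t.fac ((forget F).mapCocone s) j)
  uniq s _ h := Hom.ext (t.uniq ((forget F).mapCocone s) _ fun j => congrArg Hom.f (h j))

/-- The forgetful functor from algebras over `F` creates the colimits that `F` preserves. -/
noncomputable instance forgetCreatesColimitsOfShape : CreatesColimitsOfShape J (forget F) where
  CreatesColimit := createsColimitOfReflectsIso fun _ t =>
    { liftedCocone := liftedCocone t
      validLift := Cocone.ext (Iso.refl _) fun _ => Category.comp_id _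
      makesColimit := liftedCoconeIsColimit t }

end Colimits

instance forget_preservesFiniteLimits [HasFiniteLimits C] : PreservesFiniteLimits (forget F) where
  preservesFiniteLimits _ _ _ := inferInstance

instance forget_preservesFiniteColimits [HasFiniteColimits C] [PreservesFiniteColimits F] :
    PreservesFiniteColimits (forget F) where
  preservesFiniteColimits _ _ _ := inferInstance

instance hasFiniteLimits [HasFiniteLimits C] : HasFiniteLimits (Algebra F) where
  out _ _ _ := hasLimitsOfShape_of_hasLimitsOfShape_createsLimitsOfShape (forget F)

instance hasFiniteColimits [HasFiniteColimits C] [PreservesFiniteColimits F] :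
    HasFiniteColimits (Algebra F) where
  out _ _ _ := hasColimitsOfShape_of_hasColimitsOfShape_createsColimitsOfShape (forget F)

/-- The category of algebras over an additive right exact endofunctor of an abelian category is
abelian. -/
noncomputable abbrev abelian {A : Type u} [Category.{v} A] [Abelian A] (F : A ⥤ A) [F.Additive]
    [PreservesFiniteColimits F] : Abelian (Algebra F) := by
  have (X Y : Algebra F) (f : X ⟶ Y) : IsIso (Abelian.coimageImageComparison f) := by
    have : IsIso ((forget F).map (Abelian.coimageImageComparison f)) :=
      (Arrow.isIso_iff_isIso_of_isIso
        (Abelian.PreservesCoimageImageComparison.iso (forget F) f).hom).2 inferInstance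
    exact isIso_of_reflects_iso _ (forget F)
  exact Abelian.ofCoimageImageComparisonIsIso

end CategoryTheory.Endofunctor.Algebra

/-- If `A` is an abelian category and `F : A ⥤ A` is an exact endofunctor (preserving finite
limits and finite colimits), then the category of `F`-algebras is abelian and the forgetful
functor is exact. -/
theorem cartier_abelian {A : Type u} [Category.{v} A] [Abelian A] (F : A ⥤ A)
    [PreservesFiniteLimits F] [PreservesFiniteColimits F] :
    Nonempty (Abelian (Endofunctor.Algebra F)) ∧
      PreservesFiniteLimits (Endofunctor.Algebra.forget F) ∧
      PreservesFiniteColimits (Endofunctor.Algebra.forget F) := by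
  have : F.Additive := F.additive_of_preserves_binary_products
  exact ⟨⟨Endofunctor.Algebra.abelian F⟩, inferInstance, inferInstance⟩
end

section
/- Let A be an abelian category and G : A ⥤ A an exact endofunctor (i.e. G preserves finite limits and finite colimits). Then the category Endofunctor.Coalgebra G is abelian, and the forgetful functor Endofunctor.Coalgebra G ⥤ A is exact (preserves finite limits and finite colimits). -/
open CategoryTheory CategoryTheory.Limits

universe v u

namespace CategoryTheory.Endofunctor.Coalgebra

section Creation

variable {C : Type*} [Category* C] {F : C ⥤ C} {J : Type*} [Category* J]

/-- The structure maps, as a natural transformation out of the forgetful functor. -/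
def strNatTrans (F : C ⥤ C) : forget F ⟶ forget F ⋙ F where
  app V := V.str
  naturality _ _ f := f.h.symm

lemma str_comp_map_of_comp {V W X : Coalgebra F} {l : V.V ⟶ W.V} (p : W ⟶ X) (q : V ⟶ X)
    (h : l ≫ p.f = q.f) : (V.str ≫ F.map l) ≫ F.map p.f = (l ≫ W.str) ≫ F.map p.f := by
  rw [Category.assoc, Category.assoc, p.h, ← F.map_comp, reassoc_of% h, h, q.h]

lemma comp_str_map_of_comp {V W X : Coalgebra F} {l : W.V ⟶ V.V} (p : X ⟶ W) (q : X ⟶ V)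
    (h : p.f ≫ l = q.f) : p.f ≫ W.str ≫ F.map l = p.f ≫ l ≫ V.str := by
  rw [← p.h_assoc, ← F.map_comp, reassoc_of% h, h, q.h]

section Limits

variable {K : J ⥤ Coalgebra F} {c : Cone (K ⋙ forget F)} (hc : IsLimit (F.mapCone c))

/-- The structure map on the apex of a cone of carriers whose image under `F` is a limit cone. -/
def limitStr : c.pt ⟶ F.obj c.pt :=
  hc.lift ((Cone.postcompose (Functor.whiskerLeft K (strNatTrans F))).obj c)

lemma limitStr_map (j : J) : limitStr hc ≫ F.map (c.π.app j) = c.π.app j ≫ (K.obj j).str :=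
  hc.fac _ j

/-- The lift of a cone of carriers to a cone of coalgebras. -/
def liftedCone : Cone K where
  pt := ⟨c.pt, limitStr hc⟩
  π :=
    { app j := ⟨c.π.app j, limitStr_map hc j⟩
      naturality i j f := by
        ext
        exact c.π.naturality f }

/-- If `c` is a limit cone, then so is its lift to coalgebras. -/
def isLimitLiftedCone (t : IsLimit c) : IsLimit (liftedCone hc) where
  lift s :=
    { f := t.lift ((forget F).mapCone s)
      h := hc.hom_ext fun j => str_comp_map_of_comp
        ((liftedCone hc).π.app j) (s.π.app j) (t.fac ((forget F).mapCone s) j) }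
  fac s j := by
    ext
    exact t.fac ((forget F).mapCone s) j
  uniq s m w := by
    ext
    exact t.uniq ((forget F).mapCone s) m.f fun j => congrArg Hom.f (w j)

/-- The forgetful functor creates the limits that the endofunctor preserves. -/
noncomputable instance forgetCreatesLimit (K : J ⥤ Coalgebra F)
    [PreservesLimit (K ⋙ forget F) F] : CreatesLimit K (forget F) :=
  createsLimitOfReflectsIso fun _ t =>
    { liftedCone := liftedCone (isLimitOfPreserves F t)
      validLift := Cone.ext (Iso.refl _) fun _ => (Category.id_comp _).symm
      makesLimit := isLimitLiftedCone _ t }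

noncomputable instance forgetCreatesLimitsOfShape [PreservesLimitsOfShape J F] :
    CreatesLimitsOfShape J (forget F) where

end Limits

section Colimits

variable {K : J ⥤ Coalgebra F} {c : Cocone (K ⋙ forget F)} (t : IsColimit c)

/-- The structure map on a colimit of carriers. -/
def colimitStr : c.pt ⟶ F.obj c.pt :=
  t.desc ((Cocone.precompose (Functor.whiskerLeft K (strNatTrans F))).obj (F.mapCocone c))

lemma ι_colimitStr (j : J) : c.ι.app j ≫ colimitStr t = (K.obj j).str ≫ F.map (c.ι.app j) :=
  t.fac _ j

/-- The lift of a colimit cocone of carriers to a cocone of coalgebras. -/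
def liftedCocone : Cocone K where
  pt := ⟨c.pt, colimitStr t⟩
  ι :=
    { app j := ⟨c.ι.app j, (ι_colimitStr t j).symm⟩
      naturality i j f := by
        ext
        exact c.ι.naturality f }

/-- The lift of a colimit cocone to coalgebras is a colimit cocone. -/
def isColimitLiftedCocone : IsColimit (liftedCocone t) where
  desc s :=
    { f := t.desc ((forget F).mapCocone s)
      h := t.hom_ext fun j => comp_str_map_of_comp
        ((liftedCocone t).ι.app j) (s.ι.app j) (t.fac ((forget F).mapCocone s) j) }
  fac s j := by
    ext
    exact t.fac ((forget F).mapCocone s) j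
  uniq s m w := by
    ext
    exact t.uniq ((forget F).mapCocone s) m.f fun j => congrArg Hom.f (w j)

/-- The forgetful functor creates all colimits. -/
noncomputable instance forgetCreatesColimit (K : J ⥤ Coalgebra F) :
    CreatesColimit K (forget F) :=
  createsColimitOfReflectsIso fun _ t =>
    { liftedCocone := liftedCocone t
      validLift := Cocone.ext (Iso.refl _) fun _ => Category.comp_id _
      makesColimit := isColimitLiftedCocone t }

noncomputable instance forgetCreatesColimitsOfShape : CreatesColimitsOfShape J (forget F) where

end Colimits

end Creation

section Abelian

variable {A : Type u} [Category.{v} A] [Abelian A] (G : A ⥤ A)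

instance forget_preservesFiniteLimits [PreservesFiniteLimits G] :
    PreservesFiniteLimits (forget G) where
  preservesFiniteLimits _ := inferInstance

instance forget_preservesFiniteColimits : PreservesFiniteColimits (forget G) where
  preservesFiniteColimits _ := inferInstance

/-- Coalgebras of a left exact endofunctor of an abelian category form an abelian category. -/
@[reducible]
noncomputable def abelian [G.Additive] [PreservesFiniteLimits G] : Abelian (Coalgebra G) := by
  have hasLimits (J : Type) [SmallCategory J] [FinCategory J] :
      HasLimitsOfShape J (Coalgebra G) :=
    hasLimitsOfShape_of_hasLimitsOfShape_createsLimitsOfShape (forget G)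
  have hasColimits (J : Type) [SmallCategory J] [FinCategory J] :
      HasColimitsOfShape J (Coalgebra G) :=
    hasColimitsOfShape_of_hasColimitsOfShape_createsColimitsOfShape (forget G)
  have : HasFiniteLimits (Coalgebra G) := ⟨fun J _ _ => hasLimits J⟩
  have : HasFiniteColimits (Coalgebra G) := ⟨fun J _ _ => hasColimits J⟩
  have (X Y : Coalgebra G) (f : X ⟶ Y) : IsIso (Abelian.coimageImageComparison f) := by
    have : IsIso ((forget G).map (Abelian.coimageImageComparison f)) := by
      rw [Arrow.isIso_iff_isIso_of_isIso
        (Abelian.PreservesCoimageImageComparison.iso (forget G) f).hom]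
      infer_instance
    exact isIso_of_reflects_iso _ (forget G)
  exact Abelian.ofCoimageImageComparisonIsIso

end Abelian

end CategoryTheory.Endofunctor.Coalgebra

/-- If `A` is an abelian category and `G : A ⥤ A` is an exact endofunctor (preserving finite
limits and finite colimits), then the category of `G`-coalgebras is abelian and the forgetful
functor is exact. -/
theorem frobenius_abelian {A : Type u} [Category.{v} A] [Abelian A] (G : A ⥤ A)
    [PreservesFiniteLimits G] [PreservesFiniteColimits G] :
    Nonempty (Abelian (Endofunctor.Coalgebra G)) ∧
      PreservesFiniteLimits (Endofunctor.Coalgebra.forget G) ∧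
      PreservesFiniteColimits (Endofunctor.Coalgebra.forget G) := by
  have : G.Additive := G.additive_of_preserves_binary_products
  exact ⟨⟨Endofunctor.Coalgebra.abelian G⟩, inferInstance, inferInstance⟩
end

section
/- Let C be a category that has coproducts indexed by ℕ and let F : C ⥤ C be an endofunctor that preserves ℕ-indexed coproducts. For X in C, let L(X) be the F-algebra whose underlying object is the coproduct ∐_{n ∈ ℕ} F^n(X) (where F^n denotes the n-fold iterate of F, F^0 = identity) and whose structure map F(∐_{n ∈ ℕ} F^n(X)) ≅ ∐_{n ∈ ℕ} F^{n+1}(X) ⟶ ∐_{k ∈ ℕ} F^k(X) is induced by the coproduct inclusions of the summands F^{n+1}(X). Then X ↦ L(X) extends to a functor C ⥤ Endofunctor.Algebra F that is left adjoint to the forgetful functor Endofunctor.Algebra F ⥤ C, with unit at X given by the inclusion of the summand F^0(X) = X into ∐_{n ∈ ℕ} F^n(X). In particular, the forgetful functor is a right adjoint. -/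
open CategoryTheory CategoryTheory.Limits

universe v u

/-- The `n`-fold iterate of an endofunctor (`iterate F 0 = 𝟭 C`,
`iterate F (n+1) = iterate F n ⋙ F`). -/
def CategoryTheory.Functor.iterate {C : Type u} [Category.{v} C] (F : C ⥤ C) :
    ℕ → (C ⥤ C)
  | 0 => 𝟭 C
  | n + 1 => Functor.iterate F n ⋙ F

namespace CategoryTheory.Endofunctor.Algebra

variable {C : Type u} [Category.{v} C] [HasColimitsOfShape (Discrete ℕ) C] (F : C ⥤ C)
  [PreservesColimitsOfShape (Discrete ℕ) F]

/-- The free algebra on `X`, with carrier `∐ₙ Fⁿ X`. -/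
noncomputable def free (X : C) : Algebra F where
  a := ∐ fun n : ℕ => (F.iterate n).obj X
  str := inv (sigmaComparison F fun n : ℕ => (F.iterate n).obj X) ≫
    Limits.Sigma.desc fun n : ℕ => Sigma.ι (fun k : ℕ => (F.iterate k).obj X) (n + 1)

/-- The inclusion of the summand `Fⁿ X` in the free algebra on `X`. -/
noncomputable def freeι (X : C) (n : ℕ) : (F.iterate n).obj X ⟶ (free F X).a :=
  Sigma.ι (fun k : ℕ => (F.iterate k).obj X) n

lemma sigmaComparison_free_str (X : C) :
    sigmaComparison F (fun n : ℕ => (F.iterate n).obj X) ≫ (free F X).str =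
      Limits.Sigma.desc fun n : ℕ => Sigma.ι (fun k : ℕ => (F.iterate k).obj X) (n + 1) :=
  IsIso.hom_inv_id_assoc _ _

lemma map_freeι_str (X : C) (n : ℕ) :
    F.map (freeι F X n) ≫ (free F X).str = freeι F X (n + 1) := by
  have h := Sigma.ι (fun n : ℕ => F.obj ((F.iterate n).obj X)) n ≫= sigmaComparison_free_str F X
  exact (ι_comp_sigmaComparison_assoc F (fun n : ℕ => (F.iterate n).obj X) n _).symm.trans
    (h.trans (Sigma.ι_desc _ _))

variable {F}

lemma free_carrier_hom_ext {X Y : C} {f g : (free F X).a ⟶ Y}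
    (h : ∀ n, freeι F X n ≫ f = freeι F X n ≫ g) : f = g :=
  Sigma.hom_ext _ _ h

lemma map_free_carrier_hom_ext {X Y : C} {f g : F.obj (free F X).a ⟶ Y}
    (h : ∀ n, F.map (freeι F X n) ≫ f = F.map (freeι F X n) ≫ g) : f = g := by
  refine (cancel_epi (sigmaComparison F fun n : ℕ => (F.iterate n).obj X)).1 ?_
  refine Sigma.hom_ext _ _ fun n => ?_
  exact (ι_comp_sigmaComparison_assoc F _ n f).trans
    ((h n).trans (ι_comp_sigmaComparison_assoc F _ n g).symm)

/-- The map `Fⁿ X ⟶ A` obtained from `X ⟶ A` by iterating the structure map of `A`. -/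
def iterateLift {X : C} {A : Algebra F} (f : X ⟶ A.a) : ∀ n : ℕ, (F.iterate n).obj X ⟶ A.a
  | 0 => f
  | n + 1 => F.map (iterateLift f n) ≫ A.str

/-- The morphism out of the carrier of the free algebra on `X` with components `iterateLift f`. -/
noncomputable def freeDesc {X : C} {A : Algebra F} (f : X ⟶ A.a) : (free F X).a ⟶ A.a :=
  Limits.Sigma.desc (iterateLift f)

lemma freeι_freeDesc {X : C} {A : Algebra F} (f : X ⟶ A.a) (n : ℕ) :
    freeι F X n ≫ freeDesc f = iterateLift f n :=
  Sigma.ι_desc _ _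

/-- The algebra morphism out of the free algebra on `X` extending `X ⟶ A`. -/
noncomputable def freeLift {X : C} {A : Algebra F} (f : X ⟶ A.a) : free F X ⟶ A where
  f := freeDesc f
  h := by
    refine map_free_carrier_hom_ext fun n => ?_
    rw [← F.map_comp_assoc, freeι_freeDesc, ← Category.assoc, map_freeι_str]
    exact (freeι_freeDesc f (n + 1)).symm

lemma freeι_comp_hom {X : C} {A : Algebra F} (g : free F X ⟶ A) (n : ℕ) :
    freeι F X n ≫ g.f = iterateLift (freeι F X 0 ≫ g.f) n := by
  induction n with
  | zero => rfl
  | succ n ih =>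
    have h : (F.map (freeι F X n) ≫ (free F X).str) ≫ g.f =
        F.map (iterateLift (freeι F X 0 ≫ g.f) n) ≫ A.str := by
      rw [Category.assoc, ← g.h, ← F.map_comp_assoc, ih]
      rfl
    rwa [map_freeι_str] at h

/-- Algebra morphisms out of the free algebra on `X` correspond to morphisms out of `X`. -/
noncomputable def freeHomEquiv (X : C) (A : Algebra F) :
    (free F X ⟶ A) ≃ (X ⟶ (forget F).obj A) where
  toFun g := freeι F X 0 ≫ g.f
  invFun f := freeLift f
  left_inv g := ext <| free_carrier_hom_ext fun n =>
    (freeι_freeDesc _ n).trans (freeι_comp_hom g n).symm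
  right_inv f := freeι_freeDesc f 0

lemma freeHomEquiv_comp (X : C) (A B : Algebra F) (g : A ⟶ B) (h : free F X ⟶ A) :
    freeHomEquiv X B (h ≫ g) = freeHomEquiv X A h ≫ (forget F).map g :=
  (Category.assoc (freeι F X 0) h.f g.f).symm

end CategoryTheory.Endofunctor.Algebra

/-- If `C` has `ℕ`-indexed coproducts and `F : C ⥤ C` preserves them, then the forgetful functor
`Endofunctor.Algebra F ⥤ C` has a left adjoint `L` whose value at `X` has underlying object
`∐ (n : ℕ), Fⁿ X`, whose structure map `F (∐ₙ Fⁿ X) ≅ ∐ₙ F^{n+1} X ⟶ ∐ₖ Fᵏ X` is induced by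
the coproduct inclusions of the summands `F^{n+1} X`, and such that the unit of the adjunction
at `X` is the inclusion of the summand `F⁰ X = X`. In particular the forgetful functor is a
right adjoint. -/
theorem cartier_forget_left_adjoint {C : Type u} [Category.{v} C]
    [HasColimitsOfShape (Discrete ℕ) C] (F : C ⥤ C)
    [PreservesColimitsOfShape (Discrete ℕ) F] :
    ∃ (L : C ⥤ Endofunctor.Algebra F) (adj : L ⊣ Endofunctor.Algebra.forget F),
      ∀ X : C,
        ∃ hobj : (L.obj X).a = ∐ (fun n : ℕ => (F.iterate n).obj X),
          (sigmaComparison F (fun n : ℕ => (F.iterate n).obj X) ≫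
              F.map (eqToHom hobj.symm) ≫ (L.obj X).str ≫ eqToHom hobj =
            Sigma.desc (fun n : ℕ =>
              Sigma.ι (fun k : ℕ => (F.iterate k).obj X) (n + 1))) ∧
          adj.unit.app X ≫ eqToHom hobj =
            Sigma.ι (fun n : ℕ => (F.iterate n).obj X) 0 := by
  refine ⟨Adjunction.leftAdjointOfEquiv Endofunctor.Algebra.freeHomEquiv
      Endofunctor.Algebra.freeHomEquiv_comp,
    Adjunction.adjunctionOfEquivLeft _ _, fun X => ⟨rfl, ?_, ?_⟩⟩
  · refine Eq.trans ?_ (Endofunctor.Algebra.sigmaComparison_free_str F X)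
    refine congrArg _ ?_
    exact (congrArg (· ≫ _) (F.map_id _)).trans
      ((Category.id_comp _).trans (Category.comp_id _))
  · exact (Category.comp_id _).trans (Category.comp_id _)
end

section
/- Let C be a category that has coproducts indexed by ℕ and let G : C ⥤ C be an endofunctor that admits a left adjoint G^L : C ⥤ C. Then the forgetful functor Endofunctor.Coalgebra G ⥤ C admits a left adjoint; moreover the underlying object of the value of this left adjoint at X is the coproduct ∐_{n ∈ ℕ} (G^L)^n(X). -/
open CategoryTheory CategoryTheory.Limits

universe v u

namespace CategoryTheory.Endofunctor.Coalgebra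

variable {C : Type u} [Category.{v} C] [HasColimitsOfShape (Discrete ℕ) C] {G G' : C ⥤ C}

/-- The free `G`-coalgebra on `X`, with carrier `∐ (n : ℕ), G'ⁿ X`: the `n`-th component of its
structure map is the transpose of the inclusion of the summand `G' (G'ⁿ X) = G'ⁿ⁺¹ X`. -/
noncomputable def free (adj : G' ⊣ G) (X : C) : Coalgebra G where
  V := ∐ (fun n : ℕ => (G'.iterate n).obj X)
  str := Limits.Sigma.desc fun n => adj.homEquiv ((G'.iterate n).obj X) _
    (Sigma.ι (fun n : ℕ => (G'.iterate n).obj X) (n + 1))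

/-- The inclusion of the `n`-th summand into the free coalgebra. -/
noncomputable def freeι (adj : G' ⊣ G) (X : C) (n : ℕ) :
    (G'.iterate n).obj X ⟶ (free adj X).V :=
  Sigma.ι (fun n : ℕ => (G'.iterate n).obj X) n

lemma freeι_str (adj : G' ⊣ G) (X : C) (n : ℕ) :
    freeι adj X n ≫ (free adj X).str =
      adj.homEquiv ((G'.iterate n).obj X) _ (freeι adj X (n + 1)) :=
  Sigma.ι_desc _ _

lemma freeι_desc (adj : G' ⊣ G) {X Z : C} (k : ∀ n, (G'.iterate n).obj X ⟶ Z) (n : ℕ) :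
    (freeι adj X n ≫ Limits.Sigma.desc k : (G'.iterate n).obj X ⟶ Z) = k n :=
  Sigma.ι_desc _ _

lemma free_hom_ext {adj : G' ⊣ G} {X Z : C} {f g : (free adj X).V ⟶ Z}
    (h : ∀ n, freeι adj X n ≫ f = freeι adj X n ≫ g) : f = g :=
  Sigma.hom_ext _ _ h

/-- The components of the coalgebra morphism out of the free coalgebra extending `g`. -/
def freeLiftApp (adj : G' ⊣ G) {X : C} {M : Coalgebra G} (g : X ⟶ M.V) :
    ∀ n : ℕ, (G'.iterate n).obj X ⟶ M.V
  | 0 => g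
  | n + 1 => (adj.homEquiv ((G'.iterate n).obj X) M.V).symm (freeLiftApp adj g n ≫ M.str)

/-- A morphism out of the carrier of the free coalgebra commutes with the structure maps if and only
if each of its components determines the next one by transposition. -/
lemma free_hom_comm_iff (adj : G' ⊣ G) {X : C} {M : Coalgebra G} (f : (free adj X).V ⟶ M.V) :
    (free adj X).str ≫ G.map f = f ≫ M.str ↔
      ∀ n, freeι adj X (n + 1) ≫ f =
        (adj.homEquiv ((G'.iterate n).obj X) M.V).symm ((freeι adj X n ≫ f) ≫ M.str) := by
  have key (n : ℕ) : freeι adj X n ≫ (free adj X).str ≫ G.map f =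
      adj.homEquiv ((G'.iterate n).obj X) M.V (freeι adj X (n + 1) ≫ f) := by
    rw [← Category.assoc, freeι_str]
    exact (adj.homEquiv_naturality_right _ _).symm
  constructor
  · intro h n
    refine (Equiv.eq_symm_apply _).2 ?_
    exact (key n).symm.trans (by rw [h, Category.assoc])
  · intro h
    refine free_hom_ext fun n => ?_
    rw [← Category.assoc _ f]
    exact (key n).trans ((Equiv.eq_symm_apply _).1 (h n))

/-- The coalgebra morphism out of the free coalgebra extending `g`. -/
noncomputable def freeLift (adj : G' ⊣ G) {X : C} {M : Coalgebra G} (g : X ⟶ M.V) :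
    free adj X ⟶ M where
  f := Limits.Sigma.desc (freeLiftApp adj g)
  h := (free_hom_comm_iff adj _).2 fun n => by
    rw [freeι_desc, freeι_desc]
    rfl

lemma freeι_freeLift (adj : G' ⊣ G) {X : C} {M : Coalgebra G} (g : X ⟶ M.V) (n : ℕ) :
    freeι adj X n ≫ (freeLift adj g).f = freeLiftApp adj g n :=
  freeι_desc adj _ n

lemma freeι_hom (adj : G' ⊣ G) {X : C} {M : Coalgebra G} (f : free adj X ⟶ M) (n : ℕ) :
    freeι adj X n ≫ f.f = freeLiftApp adj (freeι adj X 0 ≫ f.f) n := by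
  induction n with
  | zero => rfl
  | succ n ih => rw [(free_hom_comm_iff adj f.f).1 f.h n, ih]; rfl

/-- Coalgebra morphisms out of the free coalgebra on `X` are morphisms out of `X`. -/
noncomputable def freeHomEquiv (adj : G' ⊣ G) (X : C) (M : Coalgebra G) :
    (free adj X ⟶ M) ≃ (X ⟶ (forget G).obj M) where
  toFun f := freeι adj X 0 ≫ f.f
  invFun g := freeLift adj g
  left_inv f := Coalgebra.ext <| free_hom_ext fun n =>
    (freeι_freeLift adj _ n).trans (freeι_hom adj f n).symm
  right_inv g := freeι_freeLift adj g 0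

lemma freeHomEquiv_comp (adj : G' ⊣ G) (X : C) (M N : Coalgebra G) (g : M ⟶ N)
    (f : free adj X ⟶ M) :
    freeHomEquiv adj X N (f ≫ g) = freeHomEquiv adj X M f ≫ (forget G).map g :=
  (Category.assoc _ _ _).symm

end CategoryTheory.Endofunctor.Coalgebra

/-- If `C` has `ℕ`-indexed coproducts and `G : C ⥤ C` admits a left adjoint `G'` (`G^L`), then
the forgetful functor `Endofunctor.Coalgebra G ⥤ C` admits a left adjoint, whose value at `X`
has underlying object the coproduct `∐ (n : ℕ), (G^L)ⁿ X`. -/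
theorem frobenius_forget_left_adjoint {C : Type u} [Category.{v} C]
    [HasColimitsOfShape (Discrete ℕ) C] (G G' : C ⥤ C) (adj : G' ⊣ G) :
    ∃ (L : C ⥤ Endofunctor.Coalgebra G) (_ : L ⊣ Endofunctor.Coalgebra.forget G),
      ∀ X : C, (L.obj X).V = ∐ (fun n : ℕ => (G'.iterate n).obj X) := by
  exact ⟨Adjunction.leftAdjointOfEquiv (Endofunctor.Coalgebra.freeHomEquiv adj)
      (Endofunctor.Coalgebra.freeHomEquiv_comp adj),
    Adjunction.adjunctionOfEquivLeft _ _, fun _ => rfl⟩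
end

section
/- Let C be a category and G : C ⥤ C an endofunctor such that the forgetful functor Endofunctor.Coalgebra G ⥤ C admits a left adjoint (for example, if C has ℕ-indexed coproducts and G has a left adjoint). Then the forgetful functor Endofunctor.Coalgebra G ⥤ C is monadic (Mathlib's CategoryTheory.MonadicRightAdjoint). -/
open CategoryTheory CategoryTheory.Limits

universe v u

namespace CategoryTheory.Endofunctor.Coalgebra

variable {C : Type u} [Category.{v} C] {G : C ⥤ C} {A B : Coalgebra G} {f g : A ⟶ B}
  {c : Cofork f.f g.f} (hc : IsColimit c)

/-- The structure morphism on a coequalizer of the underlying morphisms of `f` and `g`. -/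
def coequalizerStr : c.pt ⟶ G.obj c.pt :=
  Cofork.IsColimit.desc hc (B.str ≫ G.map c.π) (by
    rw [← Category.assoc, ← Category.assoc, ← f.h, ← g.h, Category.assoc, Category.assoc,
      ← G.map_comp, ← G.map_comp, c.condition])

theorem π_comp_coequalizerStr : c.π ≫ coequalizerStr hc = B.str ≫ G.map c.π :=
  Cofork.IsColimit.π_desc' hc _ _

/-- A coequalizer of the underlying morphisms of `f` and `g`, as a coalgebra. -/
def coequalizer : Coalgebra G where
  V := c.pt
  str := coequalizerStr hc

/-- The projection onto the coequalizer, as a morphism of coalgebras. -/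
def coequalizerπ : B ⟶ coequalizer hc where
  f := c.π
  h := (π_comp_coequalizerStr hc).symm

theorem comp_coequalizerπ : f ≫ coequalizerπ hc = g ≫ coequalizerπ hc :=
  Coalgebra.ext c.condition

/-- The cofork of coalgebras lifting a coequalizer cofork of the underlying morphisms. -/
def coequalizerCofork : Cofork f g :=
  Cofork.ofπ (coequalizerπ hc) (comp_coequalizerπ hc)

theorem comp_f_eq {Z : Coalgebra G} {k : B ⟶ Z} (w : f ≫ k = g ≫ k) :
    f.f ≫ k.f = g.f ≫ k.f :=
  congrArg Hom.f w

theorem coequalizerStr_comp_map_desc {Z : Coalgebra G} (k : B ⟶ Z)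
    (w : f.f ≫ k.f = g.f ≫ k.f) :
    coequalizerStr hc ≫ G.map (Cofork.IsColimit.desc hc k.f w) =
      Cofork.IsColimit.desc hc k.f w ≫ Z.str := by
  have hπ : c.π ≫ Cofork.IsColimit.desc hc k.f w = k.f := Cofork.IsColimit.π_desc' hc _ _
  apply Cofork.IsColimit.hom_ext hc
  rw [← Category.assoc, π_comp_coequalizerStr, Category.assoc, ← G.map_comp, hπ, k.h,
    ← Category.assoc, hπ]

/-- The morphism of coalgebras out of the coequalizer induced by a coequalizing morphism. -/
def coequalizerDesc {Z : Coalgebra G} (k : B ⟶ Z) (w : f ≫ k = g ≫ k) :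
    coequalizer hc ⟶ Z where
  f := Cofork.IsColimit.desc hc k.f (comp_f_eq w)
  h := coequalizerStr_comp_map_desc hc k (comp_f_eq w)

/-- The lifted cofork is a coequalizer of coalgebras. -/
def isColimitCoequalizerCofork : IsColimit (coequalizerCofork hc) :=
  Cofork.IsColimit.mk _ (fun s => coequalizerDesc hc s.π s.condition)
    (fun _ => Coalgebra.ext (Cofork.IsColimit.π_desc' hc _ _))
    (fun s _ hm => Coalgebra.ext (Cofork.IsColimit.hom_ext hc
      ((congrArg Hom.f hm).trans
        (Cofork.IsColimit.π_desc' hc s.π.f (comp_f_eq s.condition)).symm)))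

/-- The forgetful functor sends the lifted cofork to a coequalizer. -/
def isColimitMapCoequalizerCofork :
    IsColimit ((forget G).mapCocone (coequalizerCofork hc)) :=
  (isColimitMapCoconeCoforkEquiv (forget G) (comp_coequalizerπ hc)).symm
    (hc.ofIsoColimit (Cofork.ext (Iso.refl _) (Category.comp_id _)))

variable (G)

instance hasCoequalizerOfIsSplitPair_forget :
    Monad.HasCoequalizerOfIsSplitPair (forget G) where
  out f g _ :=
    have : HasCoequalizer f.f g.f :=
      inferInstanceAs (HasCoequalizer ((forget G).map f) ((forget G).map g))
    ⟨⟨_, isColimitCoequalizerCofork (coequalizerIsCoequalizer f.f g.f)⟩⟩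

instance preservesColimitOfIsSplitPair_forget :
    Monad.PreservesColimitOfIsSplitPair (forget G) where
  out f g _ :=
    have : HasCoequalizer f.f g.f :=
      inferInstanceAs (HasCoequalizer ((forget G).map f) ((forget G).map g))
    preservesColimit_of_preserves_colimit_cocone
      (isColimitCoequalizerCofork (coequalizerIsCoequalizer f.f g.f))
      (isColimitMapCoequalizerCofork (coequalizerIsCoequalizer f.f g.f))

end CategoryTheory.Endofunctor.Coalgebra

/-- If the forgetful functor `Endofunctor.Coalgebra G ⥤ C` admits a left adjoint (for instance
if `C` has `ℕ`-indexed coproducts and `G` has a left adjoint), then it is monadic. -/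
theorem frobenius_forget_monadic {C : Type u} [Category.{v} C] (G : C ⥤ C)
    [(Endofunctor.Coalgebra.forget G).IsRightAdjoint] :
    Nonempty (MonadicRightAdjoint (Endofunctor.Coalgebra.forget G)) :=
  ⟨Monad.monadicOfHasPreservesGSplitCoequalizersOfReflectsIsomorphisms
    (Adjunction.ofIsRightAdjoint (Endofunctor.Coalgebra.forget G))⟩
end

section
/- Let C, C', D be categories, α : C ⥤ C', U : C ⥤ D, U' : C' ⥤ D functors with a natural isomorphism α ⋙ U' ≅ U. Assume (1) U is monadic with left adjoint L, (2) U' is monadic with left adjoint L', and (3) for every object d of D, the morphism L'(d) ⟶ α(L(d)) obtained under the adjunction L' ⊣ U' as the adjunct of the composite d ⟶ U(L(d)) ≅ U'(α(L(d))) (unit of L ⊣ U followed by the given isomorphism) is an isomorphism in C'. Then α is an equivalence of categories. -/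
open CategoryTheory CategoryTheory.Limits

universe v₁ v₂ v₃ u₁ u₂ u₃

namespace MonadicComparison

variable {C : Type u₁} [Category.{v₁} C] {C' : Type u₂} [Category.{v₂} C']
  {D : Type u₃} [Category.{v₃} D]
  {α : C ⥤ C'} {U : C ⥤ D} {U' : C' ⥤ D} {L : D ⥤ C} {L' : D ⥤ C'}
  (adj' : L' ⊣ U') (e : α ⋙ U' ≅ U) (adj : L ⊣ U)

/-- The canonical morphism `L' d ⟶ α (L d)`, adjunct to `d ⟶ U (L d) ≅ U' (α (L d))`. -/
def leftAdjointMap (d : D) : L'.obj d ⟶ α.obj (L.obj d) :=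
  (adj'.homEquiv d (α.obj (L.obj d))).symm (adj.unit.app d ≫ e.inv.app (L.obj d))

lemma unit_leftAdjointMap (d : D) :
    adj'.unit.app d ≫ U'.map (leftAdjointMap adj' e adj d) =
      adj.unit.app d ≫ e.inv.app (L.obj d) :=
  (adj'.homEquiv_unit ..).symm.trans (Equiv.apply_symm_apply _ _)

lemma unit_leftAdjointMap_assoc (d : D) {X : D} (f : U'.obj (α.obj (L.obj d)) ⟶ X) :
    adj'.unit.app d ≫ U'.map (leftAdjointMap adj' e adj d) ≫ f =
      adj.unit.app d ≫ e.inv.app (L.obj d) ≫ f := by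
  simpa using! congrArg (· ≫ f) (unit_leftAdjointMap adj' e adj d)

lemma leftAdjointMap_naturality {d d' : D} (f : d ⟶ d') :
    L'.map f ≫ leftAdjointMap adj' e adj d' =
      leftAdjointMap adj' e adj d ≫ α.map (L.map f) := by
  apply (adj'.homEquiv _ _).injective
  have := e.inv.naturality (L.map f)
  dsimp at this
  simp only [Adjunction.homEquiv_unit, Functor.map_comp, unit_leftAdjointMap_assoc,
    Adjunction.unit_naturality_assoc, unit_leftAdjointMap, ← this]
  exact (adj.unit_naturality_assoc f _).symm

lemma leftAdjointMap_counit (c : C) :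
    leftAdjointMap adj' e adj (U.obj c) ≫ α.map (adj.counit.app c) =
      L'.map (e.inv.app c) ≫ adj'.counit.app (α.obj c) := by
  apply (adj'.homEquiv _ _).injective
  have := e.inv.naturality (adj.counit.app c)
  dsimp at this
  simp only [Adjunction.homEquiv_unit, Functor.map_comp, unit_leftAdjointMap_assoc,
    Adjunction.unit_naturality_assoc, ← this,
    Adjunction.right_triangle_components_assoc]
  exact ((congrArg (e.inv.app c ≫ ·) (adj'.right_triangle_components _)).trans
    (Category.comp_id _)).symm

lemma map_leftAdjointMap_comp_map_counit (c : C) :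
    U'.map (leftAdjointMap adj' e adj (U.obj c)) ≫ e.hom.app (L.obj (U.obj c)) ≫
        U.map (adj.counit.app c) =
      U'.map (L'.map (e.inv.app c)) ≫ U'.map (adj'.counit.app (α.obj c)) ≫ e.hom.app c := by
  have := e.hom.naturality (adj.counit.app c)
  dsimp at this
  rw [← this, ← Functor.map_comp_assoc, leftAdjointMap_counit, Functor.map_comp_assoc]

variable (h : ∀ d : D, IsIso (leftAdjointMap adj' e adj d))

/-- The isomorphism of functors underlying the isomorphism of induced monads. -/
noncomputable def monadFunctorIso : L' ⋙ U' ≅ L ⋙ U :=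
  NatIso.ofComponents
    (fun d => haveI := h d
      U'.mapIso (asIso (leftAdjointMap adj' e adj d)) ≪≫ e.app (L.obj d))
    (fun {d d'} f => by
      have := e.hom.naturality (L.map f)
      dsimp at this ⊢
      rw [← Functor.map_comp_assoc, leftAdjointMap_naturality, Functor.map_comp_assoc,
        Category.assoc, this])

/-- The monads induced by the two adjunctions are isomorphic. -/
noncomputable def monadIso : adj'.toMonad ≅ adj.toMonad :=
  MonadIso.mk (monadFunctorIso adj' e adj h)
    (fun d => by
      change adj'.unit.app d ≫ U'.map (leftAdjointMap adj' e adj d) ≫ e.hom.app _ = adj.unit.app d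
      exact (unit_leftAdjointMap_assoc adj' e adj d _).trans (by simp))
    (fun d => by
      change U'.map (adj'.counit.app (L'.obj d)) ≫ U'.map (leftAdjointMap adj' e adj d) ≫
          e.hom.app (L.obj d) =
        (U'.map (L'.map (U'.map (leftAdjointMap adj' e adj d) ≫ e.hom.app (L.obj d))) ≫
          U'.map (leftAdjointMap adj' e adj (U.obj (L.obj d))) ≫ e.hom.app _) ≫
            U.map (adj.counit.app (L.obj d))
      simp only [Category.assoc, map_leftAdjointMap_comp_map_counit]
      simp only [← Functor.map_comp_assoc, Category.assoc, Iso.hom_inv_id_app]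
      simp)

/-- Under the isomorphism of monads, `α` corresponds to restriction of algebras. -/
noncomputable def comparisonIso :
    α ⋙ Monad.comparison adj' ≅
      Monad.comparison adj ⋙ Monad.algebraFunctorOfMonadHom (monadIso adj' e adj h).hom :=
  NatIso.ofComponents
    (fun c => Monad.Algebra.isoMk (e.app c) (by
      change U'.map (L'.map (e.hom.app c)) ≫
          (U'.map (leftAdjointMap adj' e adj (U.obj c)) ≫ e.hom.app _) ≫
            U.map (adj.counit.app c) =
        U'.map (adj'.counit.app (α.obj c)) ≫ e.hom.app c
      simp only [Category.assoc, map_leftAdjointMap_comp_map_counit]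
      simp only [← Functor.map_comp_assoc, Iso.hom_inv_id_app]
      simp))
    (fun f => by
      ext
      exact e.hom.naturality f)

end MonadicComparison

/-- Barr–Beck criterion for an equivalence: given functors `α : C ⥤ C'`, `U : C ⥤ D`,
`U' : C' ⥤ D` with a natural isomorphism `α ⋙ U' ≅ U`, such that `U` is monadic with left
adjoint `L`, `U'` is monadic with left adjoint `L'` (monadicity expressed by the comparison
functor to the Eilenberg–Moore category being an equivalence), and such that for every `d : D`
the canonical map `L' d ⟶ α (L d)` (the adjunct under `L' ⊣ U'` of the unit `d ⟶ U (L d)`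
followed by the given isomorphism) is an isomorphism, the functor `α` is an equivalence. -/
theorem equivalence_of_monadic_of_isIso_comparison
    {C : Type u₁} [Category.{v₁} C] {C' : Type u₂} [Category.{v₂} C']
    {D : Type u₃} [Category.{v₃} D]
    (α : C ⥤ C') (U : C ⥤ D) (U' : C' ⥤ D) (e : α ⋙ U' ≅ U)
    (L : D ⥤ C) (L' : D ⥤ C') (adj : L ⊣ U) (adj' : L' ⊣ U')
    [(Monad.comparison adj).IsEquivalence] [(Monad.comparison adj').IsEquivalence]
    (h : ∀ d : D, IsIso ((adj'.homEquiv d (α.obj (L.obj d))).symm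
      (adj.unit.app d ≫ e.inv.app (L.obj d)))) :
    α.IsEquivalence := by
  have : (Monad.algebraFunctorOfMonadHom
      (MonadicComparison.monadIso adj' e adj h).hom).IsEquivalence :=
    (Monad.algebraEquivOfIsoMonads (MonadicComparison.monadIso adj' e adj h)).isEquivalence_inverse
  have : (α ⋙ Monad.comparison adj').IsEquivalence :=
    Functor.isEquivalence_of_iso (MonadicComparison.comparisonIso adj' e adj h).symm
  exact Functor.isEquivalence_of_comp_right α (Monad.comparison adj')
end
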